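/- arXiv:2106.01738 — 6 statements merged into one kernel-verified Lean document; each statement's English description precedes it below -/
import Mathlib

section
/- Let f : ℝ → ℝ be three times continuously differentiable and let x ∈ ℝ. Then, as h → 0⁺, ( Q̄_h(x) + (h/2)·f′(x) + (h²/12)·f″(x) − f(x + h/2) ) / h³ → −f‴(x)/48. In particular, the κ = 1/3 reconstruction with exact derivatives recovers the interface point value f(x + h/2) from the cell average with third-order accuracy. -/
/-- The cell average of `f` over the cell of width `h` centered at `y`. -/
noncomputable def cellAvg (f : ℝ → ℝ) (h y : ℝ) : ℝ :=
  (1 / h) * ∫ t in (y - h / 2)..(y + h / 2), f t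

open Asymptotics in
/-- A primitive of a continuous `o(t ^ n)` function, vanishing at the origin, is `o(t ^ (n + 1))`. -/
theorem intervalIntegral_isLittleO_pow_succ {R : ℝ → ℝ} {n : ℕ} (hc : Continuous R)
    (hR : R =o[nhds 0] fun t => t ^ n) :
    (fun t => ∫ s in (0 : ℝ)..t, R s) =o[nhds 0] fun t => t ^ (n + 1) := by
  have h := Convex.isLittleO_pow_succ_real (x₀ := (0 : ℝ)) (s := Set.univ) (n := n)
    (f := fun t => ∫ s in (0 : ℝ)..t, R s) (f' := R) convex_univ (Set.mem_univ _)
    (fun t _ => (hc.integral_hasStrictDerivAt 0 t).hasDerivAt.hasDerivWithinAt)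
    (by simpa using hR)
  simpa using h

open Asymptotics in
/-- The cubic Taylor expansion of a `C³` function, with Peano remainder. -/
theorem taylor_three_isLittleO {f : ℝ → ℝ} (hf : ContDiff ℝ 3 f) (x : ℝ) :
    (fun t => f (x + t) - (f x + t * deriv f x + t ^ 2 / 2 * iteratedDeriv 2 f x
      + t ^ 3 / 6 * iteratedDeriv 3 f x)) =o[nhds 0] fun t => t ^ 3 := by
  have h := taylor_isLittleO_univ (x₀ := x) (n := 3) hf
  have ht : Filter.Tendsto (fun t : ℝ => x + t) (nhds 0) (nhds x) := by
    simpa using (continuous_const_add x).tendsto 0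
  refine (h.comp_tendsto ht).congr (fun t => ?_) (fun t => ?_)
  · simp only [Function.comp_apply, taylorWithinEval_succ, taylor_within_zero_eval,
      iteratedDerivWithin_univ, add_sub_cancel_left, smul_eq_mul, Nat.factorial, zero_add,
      iteratedDeriv_one]
    push_cast
    ring
  · simp

/-- The cell average of a cubic polynomial plus a remainder. -/
theorem cellAvg_eq_of_cubic_add {f R : ℝ → ℝ} (hR : Continuous R) (x a b c d : ℝ)
    (hf : ∀ t, f (x + t) = a + t * b + t ^ 2 / 2 * c + t ^ 3 / 6 * d + R t) {h : ℝ} (hh : h ≠ 0) :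
    cellAvg f h x = a + h ^ 2 / 24 * c
      + ((∫ s in (0 : ℝ)..(h / 2), R s) - ∫ s in (0 : ℝ)..(-(h / 2)), R s) / h := by
  have hshift : ∫ t in (x - h / 2)..(x + h / 2), f t = ∫ t in (-(h / 2))..(h / 2), f (x + t) := by
    rw [intervalIntegral.integral_comp_add_left, ← sub_eq_add_neg]
  have hpoly : ∫ t in (-(h / 2))..(h / 2), (a + t * b + t ^ 2 / 2 * c + t ^ 3 / 6 * d)
      = h * (a + h ^ 2 / 24 * c) := by
    have hd : ∀ t : ℝ, HasDerivAt
        (fun t => a * t + t ^ 2 * (b / 2) + t ^ 3 * (c / 6) + t ^ 4 * (d / 24))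
        (a + t * b + t ^ 2 / 2 * c + t ^ 3 / 6 * d) t := fun t => by
      refine HasDerivAt.congr_deriv (((((hasDerivAt_id t).const_mul a).add ((hasDerivAt_pow 2 t).mul_const (b / 2))).add
        ((hasDerivAt_pow 3 t).mul_const (c / 6))).add
        ((hasDerivAt_pow 4 t).mul_const (d / 24))) ?_
      push_cast
      ring
    rw [intervalIntegral.integral_eq_sub_of_hasDerivAt (fun t _ => hd t)
      (Continuous.intervalIntegrable (by fun_prop) _ _)]
    ring
  rw [cellAvg, hshift, intervalIntegral.integral_congr (fun t _ => hf t),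
    intervalIntegral.integral_add (Continuous.intervalIntegrable (by fun_prop) _ _)
      (hR.intervalIntegrable _ _), hpoly,
    intervalIntegral.integral_interval_sub_left (hR.intervalIntegrable _ _)
      (hR.intervalIntegrable _ _)]
  field_simp

/-- the κ = 1/3 reconstruction with exact derivatives recovers
the interface value `f (x + h/2)` with third-order accuracy, with leading
error coefficient `-f‴(x)/48`. -/
theorem kappa_third_reconstruction_exact_derivatives
    (f : ℝ → ℝ) (hf : ContDiff ℝ 3 f) (x : ℝ) :
    Filter.Tendsto
      (fun h : ℝ =>
        (cellAvg f h x + (h / 2) * deriv f x + (h ^ 2 / 12) * iteratedDeriv 2 f x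
          - f (x + h / 2)) / h ^ 3)
      (nhdsWithin 0 (Set.Ioi 0))
      (nhds (-(iteratedDeriv 3 f x) / 48)) := by
  set R : ℝ → ℝ := fun t => f (x + t) - (f x + t * deriv f x + t ^ 2 / 2 * iteratedDeriv 2 f x
      + t ^ 3 / 6 * iteratedDeriv 3 f x) with hRdef
  have hfc : Continuous f := hf.continuous
  have hRc : Continuous R := by fun_prop
  have hR : Asymptotics.IsLittleO (nhds 0) R fun t => t ^ 3 := taylor_three_isLittleO hf x
  set G : ℝ → ℝ := fun t => ∫ s in (0 : ℝ)..t, R s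
  have hG : Asymptotics.IsLittleO (nhds 0) G fun t => t ^ 4 := intervalIntegral_isLittleO_pow_succ hRc hR
  have hpos : Filter.Tendsto (fun h : ℝ => h / 2) (nhdsWithin 0 (Set.Ioi 0)) (nhds 0) :=
    Filter.Tendsto.mono_left (Continuous.tendsto' (by fun_prop) _ _ (by simp)) nhdsWithin_le_nhds
  have hneg : Filter.Tendsto (fun h : ℝ => -(h / 2)) (nhdsWithin 0 (Set.Ioi 0)) (nhds 0) := by
    simpa using hpos.neg
  have hlim := ((((hG.tendsto_div_nhds_zero.comp hpos).sub
    (hG.tendsto_div_nhds_zero.comp hneg)).div_const 16).sub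
    ((hR.tendsto_div_nhds_zero.comp hpos).div_const 8)).const_add (-(iteratedDeriv 3 f x) / 48)
  simp only [sub_zero, zero_div, add_zero] at hlim
  refine hlim.congr' ?_
  filter_upwards [self_mem_nhdsWithin] with h (hh : 0 < h)
  have hh0 : h ≠ 0 := hh.ne'
  have hfR : f (x + h / 2) = f x + h / 2 * deriv f x + (h / 2) ^ 2 / 2 * iteratedDeriv 2 f x
      + (h / 2) ^ 3 / 6 * iteratedDeriv 3 f x + R (h / 2) := by
    simp only [hRdef]; ring
  rw [hfR, cellAvg_eq_of_cubic_add hRc x (f x) (deriv f x) (iteratedDeriv 2 f x)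
    (iteratedDeriv 3 f x) (fun t => by simp only [hRdef]; ring) hh0]
  change _ = (f x + h ^ 2 / 24 * iteratedDeriv 2 f x + (G (h / 2) - G (-(h / 2))) / h
    + _ + _ - _) / _
  simp only [Function.comp_apply]
  clear_value G R
  field_simp
  ring
end

section
/- Let f : ℝ → ℝ be infinitely differentiable and let x ∈ ℝ. Then there exist constants C > 0 and h₀ > 0 such that for all 0 < h < h₀, | (2·Q̄_h(x − 2h) − 13·Q̄_h(x − h) + 47·Q̄_h(x) + 27·Q̄_h(x + h) − 3·Q̄_h(x + 2h))/60 − f(x + h/2) | ≤ C·h⁵. That is, the linear (unlimited) part of the MP5 reconstruction approximates the interface value f(x_{j+1/2}) from five consecutive cell averages with fifth-order accuracy. -/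
/-- A `C^(n+1)` function agrees near `x` with a polynomial of degree at most `n` up to an error
of order `n + 1`. -/
theorem exists_local_taylor_bound {f : ℝ → ℝ} {n : ℕ} (hf : ContDiff ℝ (n + 1 : ℕ) f) (x : ℝ) :
    ∃ a : ℕ → ℝ, ∃ M > (0 : ℝ), ∃ δ > (0 : ℝ), ∀ t, |t - x| < δ →
      |f t - ∑ k ∈ Finset.range (n + 1), a k * (t - x) ^ k| ≤ M * |t - x| ^ (n + 1) := by
  set a : ℕ → ℝ := fun k => ((k.factorial : ℝ)⁻¹) * iteratedDerivWithin k f Set.univ x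
  have hbound := (taylor_isLittleO_univ (x₀ := x) hf).def one_pos
  obtain ⟨δ, hδ, hball⟩ := Metric.eventually_nhds_iff.1 hbound
  refine ⟨a, 1 + |a (n + 1)|, by positivity, δ, hδ, fun t ht => ?_⟩
  have h := hball (y := t) (by rwa [Real.dist_eq])
  have heval : taylorWithinEval f (n + 1) Set.univ x t
      = (∑ k ∈ Finset.range (n + 1), a k * (t - x) ^ k) + a (n + 1) * (t - x) ^ (n + 1) := by
    rw [taylor_within_apply, Finset.sum_range_succ]
    simp only [a, smul_eq_mul, mul_right_comm]
  rw [heval, Real.norm_eq_abs, Real.norm_eq_abs, one_mul, abs_pow] at h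
  calc |f t - ∑ k ∈ Finset.range (n + 1), a k * (t - x) ^ k|
      = |(f t - ((∑ k ∈ Finset.range (n + 1), a k * (t - x) ^ k) + a (n + 1) * (t - x) ^ (n + 1)))
          + a (n + 1) * (t - x) ^ (n + 1)| := by congr 1; ring
    _ ≤ |t - x| ^ (n + 1) + |a (n + 1)| * |t - x| ^ (n + 1) := by
        refine (abs_add_le _ _).trans ?_
        rw [abs_mul, abs_pow]
        gcongr
    _ = (1 + |a (n + 1)|) * |t - x| ^ (n + 1) := by ring

theorem cellAvg_sub {f g : ℝ → ℝ} (hf : Continuous f) (hg : Continuous g) (h y : ℝ) :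
    cellAvg (fun t => f t - g t) h y = cellAvg f h y - cellAvg g h y := by
  simp only [cellAvg]
  rw [intervalIntegral.integral_sub (hf.intervalIntegrable _ _) (hg.intervalIntegrable _ _)]
  ring

theorem abs_cellAvg_le {f : ℝ → ℝ} {h y B : ℝ} (hh : 0 < h)
    (hB : ∀ t, |t - y| ≤ h / 2 → |f t| ≤ B) : |cellAvg f h y| ≤ B := by
  have hint : ‖∫ t in (y - h / 2)..(y + h / 2), f t‖ ≤ B * |y + h / 2 - (y - h / 2)| := by
    refine intervalIntegral.norm_integral_le_of_norm_le_const fun t ht => hB t ?_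
    rw [Set.uIoc_of_le (by linarith)] at ht
    exact abs_le.2 ⟨by linarith [ht.1], by linarith [ht.2]⟩
  rw [show y + h / 2 - (y - h / 2) = h by ring, abs_of_pos hh, Real.norm_eq_abs] at hint
  rw [cellAvg, abs_mul, abs_of_pos (by positivity), one_div_mul_eq_div, div_le_iff₀ hh]
  exact hint

theorem cellAvg_sum_pow (a : ℕ → ℝ) (n : ℕ) (h x y : ℝ) :
    cellAvg (fun t => ∑ k ∈ Finset.range n, a k * (t - x) ^ k) h y
      = (1 / h) * ∑ k ∈ Finset.range n,
          a k * (((y + h / 2 - x) ^ (k + 1) - (y - h / 2 - x) ^ (k + 1)) / (k + 1)) := by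
  rw [cellAvg, intervalIntegral.integral_finsetSum
    fun k _ => Continuous.intervalIntegrable (by fun_prop) _ _]
  congr 1
  refine Finset.sum_congr rfl fun k _ => ?_
  rw [intervalIntegral.integral_const_mul,
    intervalIntegral.integral_comp_sub_right (fun t => t ^ k), integral_pow]

/-- The linear MP5 reconstruction is exact on polynomials of degree at most four. -/
theorem mp5_linear_exact (a : ℕ → ℝ) {h : ℝ} (hh : h ≠ 0) (x : ℝ) {p : ℝ → ℝ}
    (hp : p = fun t => ∑ k ∈ Finset.range 5, a k * (t - x) ^ k) :
    (2 * cellAvg p h (x - 2 * h) - 13 * cellAvg p h (x - h) + 47 * cellAvg p h x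
      + 27 * cellAvg p h (x + h) - 3 * cellAvg p h (x + 2 * h)) / 60 = p (x + h / 2) := by
  subst hp
  simp only [cellAvg_sum_pow]
  simp only [Finset.sum_range_succ, Finset.sum_range_zero]
  push_cast
  field_simp
  ring

/-- the linear (unlimited) part of the MP5 reconstruction
approximates the interface value `f (x + h/2)` from five consecutive cell
averages with fifth-order accuracy. -/
theorem mp5_linear_reconstruction_fifth_order
    (f : ℝ → ℝ) (hf : ContDiff ℝ (⊤ : ℕ∞) f) (x : ℝ) :
    ∃ C > (0 : ℝ), ∃ h₀ > (0 : ℝ), ∀ h : ℝ, 0 < h → h < h₀ →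
      |(2 * cellAvg f h (x - 2 * h) - 13 * cellAvg f h (x - h) + 47 * cellAvg f h x
          + 27 * cellAvg f h (x + h) - 3 * cellAvg f h (x + 2 * h)) / 60
        - f (x + h / 2)| ≤ C * h ^ 5 := by
  obtain ⟨a, M, hM, δ, hδ, hbound⟩ :=
    exists_local_taylor_bound (n := 4) (contDiff_infty.1 hf _) x
  set p : ℝ → ℝ := fun t => ∑ k ∈ Finset.range 5, a k * (t - x) ^ k with hp
  have hpc : Continuous p := by fun_prop
  refine ⟨M * 3 ^ 5 * 3, by positivity, δ / 3, by positivity, fun h hh hlt => ?_⟩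
  have hr : ∀ t, |t - x| ≤ 5 / 2 * h → |f t - p t| ≤ M * (3 * h) ^ 5 := fun t ht =>
    (hbound t (by linarith)).trans (by gcongr; linarith)
  have havg : ∀ y, |y - x| ≤ 2 * h → |cellAvg f h y - cellAvg p h y| ≤ M * (3 * h) ^ 5 := by
    intro y hy
    rw [← cellAvg_sub hf.continuous hpc]
    exact abs_cellAvg_le hh fun t ht => hr t (by linarith [abs_sub_le t y x])
  have h₁ := abs_le.1 (havg (x - 2 * h) (abs_le.2 ⟨by linarith, by linarith⟩))
  have h₂ := abs_le.1 (havg (x - h) (abs_le.2 ⟨by linarith, by linarith⟩))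
  have h₃ := abs_le.1 (havg x (abs_le.2 ⟨by linarith, by linarith⟩))
  have h₄ := abs_le.1 (havg (x + h) (abs_le.2 ⟨by linarith, by linarith⟩))
  have h₅ := abs_le.1 (havg (x + 2 * h) (abs_le.2 ⟨by linarith, by linarith⟩))
  have h₆ := abs_le.1 (hr (x + h / 2) (abs_le.2 ⟨by linarith, by linarith⟩))
  have hexact := mp5_linear_exact a hh.ne' x hp
  have hE : 0 ≤ M * (3 * h) ^ 5 := by positivity
  rw [show M * 3 ^ 5 * 3 * h ^ 5 = 3 * (M * (3 * h) ^ 5) by ring]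
  exact abs_le.2 ⟨by linarith, by linarith⟩
end

section
/- Let f : ℝ → ℝ be infinitely differentiable and let x ∈ ℝ. Then there exist constants C > 0 and h₀ > 0 such that for all 0 < h < h₀, | (1/2)·f(x − h/2) + f(x + h/2) + (1/6)·f(x + 3h/2) − ( (1/18)·Q̄_h(x − h) + (19/18)·Q̄_h(x) + (5/9)·Q̄_h(x + h) ) | ≤ C·h⁵. That is, the exact interface values of f satisfy the fifth-order compact reconstruction relation (C5 scheme) with residual of order h⁵. -/
/-- Near `x`, a `C⁵` function differs from some quartic polynomial by `O(|t - x|⁵)`. -/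
lemma exists_quartic_taylor_bound {f : ℝ → ℝ} (hf : ContDiff ℝ 5 f) (x : ℝ) :
    ∃ c : Fin 5 → ℝ, ∃ K > (0 : ℝ), ∃ ε > (0 : ℝ), ∀ t, |t - x| < ε →
      |f t - ∑ i, c i * (t - x) ^ (i : ℕ)| ≤ K * |t - x| ^ 5 := by
  have hlo := taylor_isLittleO_univ (x₀ := x) (n := 5) hf
  obtain ⟨ε, hε, hb⟩ := Metric.eventually_nhds_iff.1 (hlo.bound one_pos)
  refine ⟨fun i => (i.val.factorial : ℝ)⁻¹ * iteratedDerivWithin i f Set.univ x,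
    |((Nat.factorial 5 : ℕ) : ℝ)⁻¹ * iteratedDerivWithin 5 f Set.univ x| + 1,
    by positivity, ε, hε, fun t ht => ?_⟩
  have h := hb (y := t) (by simpa [Real.dist_eq] using ht)
  rw [taylor_within_apply, Finset.sum_range_succ, Finset.sum_range, Real.norm_eq_abs,
    Real.norm_eq_abs, one_mul, abs_pow] at h
  simp only [smul_eq_mul, mul_right_comm _ ((t - x) ^ _)] at h
  rw [add_mul, one_mul, ← abs_pow, ← abs_mul, abs_pow]
  set S := ∑ i : Fin 5, (i.val.factorial : ℝ)⁻¹ * iteratedDerivWithin i f Set.univ x *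
    (t - x) ^ (i : ℕ)
  set R := ((Nat.factorial 5 : ℕ) : ℝ)⁻¹ * iteratedDerivWithin 5 f Set.univ x * (t - x) ^ 5
  calc |f t - S| = |R + (f t - (S + R))| := by ring_nf
    _ ≤ |R| + |f t - (S + R)| := abs_add_le _ _
    _ ≤ |R| + |t - x| ^ 5 := by gcongr

/-- A uniform approximation of `f` by `P'` on a cell gives an approximation of the cell average
of `f` by a difference quotient of `P`. -/
lemma abs_cellAvg_sub_le {f p P : ℝ → ℝ} {h y M : ℝ} (hh : 0 < h) (hf : Continuous f)
    (hp : Continuous p) (hP : ∀ t, HasDerivAt P (p t) t)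
    (hM : ∀ t, |t - y| ≤ h / 2 → |f t - p t| ≤ M) :
    |cellAvg f h y - (P (y + h / 2) - P (y - h / 2)) / h| ≤ M := by
  have hint : ∫ t in (y - h / 2)..(y + h / 2), p t = P (y + h / 2) - P (y - h / 2) :=
    intervalIntegral.integral_eq_sub_of_hasDerivAt (fun t _ => hP t) (hp.intervalIntegrable _ _)
  have hsub : cellAvg f h y - (P (y + h / 2) - P (y - h / 2)) / h
      = (∫ t in (y - h / 2)..(y + h / 2), (f t - p t)) / h := by
    rw [intervalIntegral.integral_sub (hf.intervalIntegrable _ _) (hp.intervalIntegrable _ _),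
      hint, cellAvg]
    ring
  have hbound : ‖∫ t in (y - h / 2)..(y + h / 2), (f t - p t)‖
      ≤ M * |y + h / 2 - (y - h / 2)| := by
    refine intervalIntegral.norm_integral_le_of_norm_le_const fun t ht => hM t ?_
    rw [Set.uIoc_of_le (by linarith)] at ht
    exact abs_le.2 ⟨by linarith [ht.1], by linarith [ht.2]⟩
  rw [show y + h / 2 - (y - h / 2) = h by ring, abs_of_pos hh] at hbound
  rw [hsub, abs_div, abs_of_pos hh, div_le_iff₀ hh]
  exact hbound

/-- the exact interface values of `f` satisfy the fifth-order
compact reconstruction relation (C5 scheme of Pirozzoli) with residual of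
order `h⁵`. -/
theorem c5_compact_reconstruction_fifth_order
    (f : ℝ → ℝ) (hf : ContDiff ℝ (⊤ : ℕ∞) f) (x : ℝ) :
    ∃ C > (0 : ℝ), ∃ h₀ > (0 : ℝ), ∀ h : ℝ, 0 < h → h < h₀ →
      |(1 / 2) * f (x - h / 2) + f (x + h / 2) + (1 / 6) * f (x + 3 * h / 2)
        - ((1 / 18) * cellAvg f h (x - h) + (19 / 18) * cellAvg f h x
            + (5 / 9) * cellAvg f h (x + h))| ≤ C * h ^ 5 := by
  obtain ⟨c, K, hK, ε, hε, hT⟩ :=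
    exists_quartic_taylor_bound (contDiff_infty.1 hf 5) x
  refine ⟨10 / 3 * (K * (3 / 2) ^ 5), by positivity, ε / 2, by positivity, fun h hh hlt => ?_⟩
  set p : ℝ → ℝ := fun t => ∑ i, c i * (t - x) ^ (i : ℕ) with hp
  set P : ℝ → ℝ := fun t => ∑ i, c i * ((t - x) ^ ((i : ℕ) + 1) / ((i : ℕ) + 1)) with hP
  have hpc : Continuous p := by fun_prop
  have hder : ∀ t, HasDerivAt P (p t) t := fun t => by
    refine HasDerivAt.fun_sum fun i _ => HasDerivAt.const_mul _ ?_
    convert (((hasDerivAt_id' t).sub_const x).fun_pow ((i : ℕ) + 1)).div_const ((i : ℝ) + 1) using 1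
    have : ((i : ℕ) : ℝ) + 1 ≠ 0 := by positivity
    push_cast
    field_simp
  have hpt : ∀ t, |t - x| ≤ 3 * h / 2 → |f t - p t| ≤ K * (3 * h / 2) ^ 5 := fun t ht =>
    (hT t (by linarith)).trans (by gcongr)
  have hcell : ∀ y, |y - x| ≤ h →
      |cellAvg f h y - (P (y + h / 2) - P (y - h / 2)) / h| ≤ K * (3 * h / 2) ^ 5 := fun y hy =>
    abs_cellAvg_sub_le hh hf.continuous hpc hder fun t ht => hpt t <| by
      linarith [abs_sub_le t y x]
  have hexact : (1 / 2) * p (x - h / 2) + p (x + h / 2) + (1 / 6) * p (x + 3 * h / 2)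
      = (1 / 18) * ((P (x - h + h / 2) - P (x - h - h / 2)) / h)
        + (19 / 18) * ((P (x + h / 2) - P (x - h / 2)) / h)
        + (5 / 9) * ((P (x + h + h / 2) - P (x + h - h / 2)) / h) := by
    simp only [hp, hP, Fin.sum_univ_five]
    norm_num
    field_simp
    ring
  have e₁ := abs_le.1 (hpt (x - h / 2) (abs_le.2 ⟨by linarith, by linarith⟩))
  have e₂ := abs_le.1 (hpt (x + h / 2) (abs_le.2 ⟨by linarith, by linarith⟩))
  have e₃ := abs_le.1 (hpt (x + 3 * h / 2) (abs_le.2 ⟨by linarith, by linarith⟩))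
  have e₄ := abs_le.1 (hcell (x - h) (abs_le.2 ⟨by linarith, by linarith⟩))
  have e₅ := abs_le.1 (hcell x (abs_le.2 ⟨by linarith, by linarith⟩))
  have e₆ := abs_le.1 (hcell (x + h) (abs_le.2 ⟨by linarith, by linarith⟩))
  have hC : 10 / 3 * (K * (3 / 2) ^ 5) * h ^ 5 = 10 / 3 * (K * (3 * h / 2) ^ 5) := by ring
  rw [hC]
  exact abs_le.2 ⟨by linarith, by linarith⟩
end

section
/- Let α ∈ ℝ, let f : ℝ → ℝ be infinitely differentiable, and let x ∈ ℝ. Then there exist constants C > 0 and h₀ > 0 such that for all 0 < h < h₀, | α·f′(x − h) + f′(x) + α·f′(x + h) − ( ((4α − 1)/(12h))·(f(x + 2h) − f(x − 2h)) + ((α + 2)/(3h))·(f(x + h) − f(x − h)) ) | ≤ C·h⁴. That is, the one-parameter tridiagonal compact finite-difference family with β = 0, a = (2/3)(α + 2), b = (1/3)(4α − 1), c = 0 is fourth-order accurate for every value of the parameter α. -/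
/-- Taylor's formula with a remainder of the form `r * t ^ n`, where `|r| ≤ 1` near the centre. -/
theorem exists_taylor_remainder_coeff {g : ℝ → ℝ} {n : ℕ} (hg : ContDiff ℝ n g) (x : ℝ) :
    ∃ δ > (0 : ℝ), ∀ t : ℝ, |t| < δ → ∃ r : ℝ, |r| ≤ 1 ∧
      g (x + t) = ∑ k ∈ Finset.range (n + 1), iteratedDeriv k g x * t ^ k / (k.factorial : ℝ)
        + r * t ^ n := by
  have hbound := (taylor_isLittleO_univ (x₀ := x) hg).bound one_pos
  obtain ⟨δ, hδ, hball⟩ := Metric.eventually_nhds_iff.1 hbound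
  refine ⟨δ, hδ, fun t ht => ?_⟩
  have hrem := hball (y := x + t) (by simpa [Real.dist_eq] using ht)
  have heval : taylorWithinEval g n Set.univ x (x + t)
      = ∑ k ∈ Finset.range (n + 1), iteratedDeriv k g x * t ^ k / (k.factorial : ℝ) := by
    rw [taylor_within_apply]
    refine Finset.sum_congr rfl fun k _ => ?_
    rw [iteratedDerivWithin_univ, add_sub_cancel_left, smul_eq_mul]
    ring
  rw [heval, add_sub_cancel_left, one_mul, Real.norm_eq_abs, Real.norm_eq_abs] at hrem
  rcases eq_or_ne (t ^ n) 0 with h0 | h0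
  · refine ⟨0, by simp, ?_⟩
    rw [h0, abs_zero] at hrem
    linarith [abs_nonpos_iff.1 hrem]
  · refine ⟨_ / t ^ n, ?_, by rw [div_mul_cancel₀ _ h0, add_sub_cancel]⟩
    rw [abs_div]
    exact div_le_one_of_le₀ hrem (abs_nonneg _)

/-- the one-parameter tridiagonal compact finite-difference
family (β = 0, a = (2/3)(α+2), b = (1/3)(4α−1), c = 0) for the first
derivative is fourth-order accurate for every value of the parameter α. -/
theorem tridiagonal_compact_family_fourth_order
    (α : ℝ) (f : ℝ → ℝ) (hf : ContDiff ℝ (⊤ : ℕ∞) f) (x : ℝ) :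
    ∃ C > (0 : ℝ), ∃ h₀ > (0 : ℝ), ∀ h : ℝ, 0 < h → h < h₀ →
      |α * deriv f (x - h) + deriv f x + α * deriv f (x + h)
        - (((4 * α - 1) / (12 * h)) * (f (x + 2 * h) - f (x - 2 * h))
            + ((α + 2) / (3 * h)) * (f (x + h) - f (x - h)))| ≤ C * h ^ 4 := by
  obtain ⟨δ, hδ, hT⟩ := exists_taylor_remainder_coeff (contDiff_infty.1 hf 5) x
  have hf' : ContDiff ℝ (4 : ℕ) (deriv f) :=
    ((contDiff_succ_iff_deriv (n := (4 : ℕ))).1 (contDiff_infty.1 hf 5)).2.2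
  obtain ⟨ε, hε, hT'⟩ := exists_taylor_remainder_coeff hf' x
  simp only [← iteratedDeriv_succ'] at hT'
  set D : ℕ → ℝ := fun k => iteratedDeriv k f x with hD
  have hD1 : deriv f x = D 1 := by simp [hD, iteratedDeriv_one]
  set c : ℝ := (α / 12 - 2 * (4 * α - 1) / 45 - (α + 2) / 180) * D 5 with hc
  refine ⟨|c| + 2 * |α| + 16 / 3 * |4 * α - 1| + 2 / 3 * |α + 2| + 1, by positivity,
    min (δ / 2) ε, by positivity, fun h h0 hh => ?_⟩
  obtain ⟨hhδ, hhε⟩ := lt_min_iff.1 hh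
  obtain ⟨s₁, hs₁, e₁⟩ := hT' h (by rwa [abs_of_pos h0])
  obtain ⟨s₂, hs₂, e₂⟩ := hT' (-h) (by rwa [abs_neg, abs_of_pos h0])
  obtain ⟨r₁, hr₁, e₃⟩ := hT h (by rw [abs_of_pos h0]; linarith)
  obtain ⟨r₂, hr₂, e₄⟩ := hT (-h) (by rw [abs_neg, abs_of_pos h0]; linarith)
  obtain ⟨r₃, hr₃, e₅⟩ := hT (2 * h) (by rw [abs_of_pos (by linarith)]; linarith)
  obtain ⟨r₄, hr₄, e₆⟩ := hT (-(2 * h)) (by rw [abs_neg, abs_of_pos (by linarith)]; linarith)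
  rw [← sub_eq_add_neg] at e₂ e₄ e₆
  have key : α * deriv f (x - h) + deriv f x + α * deriv f (x + h)
        - (((4 * α - 1) / (12 * h)) * (f (x + 2 * h) - f (x - 2 * h))
            + ((α + 2) / (3 * h)) * (f (x + h) - f (x - h)))
      = (c + α * (s₁ + s₂) - 8 / 3 * (4 * α - 1) * (r₃ + r₄) - 1 / 3 * (α + 2) * (r₁ + r₂))
        * h ^ 4 := by
    rw [e₁, e₂, e₃, e₄, e₅, e₆, hD1, hc]
    simp only [hD, Finset.sum_range_succ, Finset.sum_range_zero, Nat.factorial]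
    push_cast
    field_simp
    ring
  have hpair : ∀ {a u v : ℝ}, |u| ≤ 1 → |v| ≤ 1 → |a * (u + v)| ≤ 2 * |a| := by
    intro a u v hu hv
    rw [abs_mul, mul_comm]
    exact mul_le_mul_of_nonneg_right (by linarith [abs_add_le u v]) (abs_nonneg a)
  have h₁ := hpair (a := α) hs₁ hs₂
  have h₂ := hpair (a := 8 / 3 * (4 * α - 1)) hr₃ hr₄
  have h₃ := hpair (a := 1 / 3 * (α + 2)) hr₁ hr₂
  rw [abs_mul (8 / 3) (4 * α - 1), abs_of_pos (by norm_num : (0 : ℝ) < 8 / 3)] at h₂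
  rw [abs_mul (1 / 3) (α + 2), abs_of_pos (by norm_num : (0 : ℝ) < 1 / 3)] at h₃
  rw [key, abs_mul, abs_of_pos (pow_pos h0 4)]
  refine mul_le_mul_of_nonneg_right ?_ (pow_pos h0 4).le
  refine (abs_sub _ _).trans ?_
  linarith [abs_sub (c + α * (s₁ + s₂)) (8 / 3 * (4 * α - 1) * (r₃ + r₄)),
    abs_add_le c (α * (s₁ + s₂))]
end

section
/- Let f : ℝ → ℝ be four times continuously differentiable and let x ∈ ℝ. Then, as h → 0⁺, ( f′(x) + 2·f′(x + h) − (1/h)·( −(5/2)·f(x) + 2·f(x + h) + (1/2)·f(x + 2h) ) ) / h³ → −f⁗(x)/12. That is, the one-sided boundary compact formula Q′₀ + 2Q′₁ = (1/Δx)(−(5/2)Q₀ + 2Q₁ + (1/2)Q₂) is third-order accurate. -/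
open Filter Topology Finset in
/-- Taylor's theorem as a limit along the scaled increments `c * h`, `h → 0⁺`. -/
theorem tendsto_taylor_remainder_div_pow {g : ℝ → ℝ} {n : ℕ} (hg : ContDiff ℝ n g) (x c : ℝ) :
    Tendsto (fun h : ℝ => (g (x + c * h)
        - ∑ k ∈ range (n + 1), iteratedDeriv k g x * (c * h) ^ k / k.factorial) / (c * h) ^ n)
      (𝓝[>] 0) (𝓝 0) := by
  have hlim : Tendsto (fun h : ℝ => x + c * h) (𝓝[>] 0) (𝓝 x) := by
    have : Tendsto (fun h : ℝ => x + c * h) (𝓝 0) (𝓝 (x + c * 0)) :=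
      Continuous.tendsto (by fun_prop) 0
    simpa using this.mono_left nhdsWithin_le_nhds
  refine (((taylor_isLittleO_univ (x₀ := x) hg).tendsto_div_nhds_zero).comp hlim).congr fun h => ?_
  simp only [Function.comp_apply, taylor_within_apply, iteratedDerivWithin_univ,
    add_sub_cancel_left, smul_eq_mul]
  congr 2
  exact sum_congr rfl fun k _ => by ring

/-- the one-sided boundary compact formula
`Q′₀ + 2Q′₁ = (1/h)(−(5/2)Q₀ + 2Q₁ + (1/2)Q₂)` is third-order accurate, with
leading error coefficient `−f⁗(x)/12`. -/
theorem boundary_compact_formula_third_order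
    (f : ℝ → ℝ) (hf : ContDiff ℝ 4 f) (x : ℝ) :
    Filter.Tendsto
      (fun h : ℝ =>
        (deriv f x + 2 * deriv f (x + h)
          - (1 / h) * (-(5 / 2) * f x + 2 * f (x + h) + (1 / 2) * f (x + 2 * h))) / h ^ 3)
      (nhdsWithin 0 (Set.Ioi 0))
      (nhds (-(iteratedDeriv 4 f x) / 12)) := by
  have hf' : ContDiff ℝ (3 : ℕ) (deriv f) := by
    have h4 : ContDiff ℝ ((3 : ℕ) + 1) f := by
      convert hf using 1
      norm_num
    exact (contDiff_succ_iff_deriv.1 h4).2.2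
  have hD := tendsto_taylor_remainder_div_pow hf' x 1
  have hF := tendsto_taylor_remainder_div_pow (n := 4) hf x 1
  have hF₂ := tendsto_taylor_remainder_div_pow (n := 4) hf x 2
  have hsum := (((hD.const_mul 2).sub (hF.const_mul 2)).sub (hF₂.const_mul 8)).add_const
    (-(iteratedDeriv 4 f x) / 12)
  simp only [mul_zero, sub_zero, zero_add] at hsum
  refine hsum.congr' ?_
  filter_upwards [self_mem_nhdsWithin] with h hh
  have h0 : h ≠ 0 := ne_of_gt hh
  simp only [Finset.sum_range_succ, Finset.sum_range_zero, ← iteratedDeriv_succ',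
    iteratedDeriv_zero, zero_add, Nat.reduceAdd, iteratedDeriv_one, Nat.factorial, one_mul]
  push_cast
  field_simp
  ring
end

section
/- Let m₁ = α₁ρ₁ and m₂ = α₂ρ₂ be real numbers with ρ := m₁ + m₂ > 0, let α₁, u, v, p, E, S, S* ∈ ℝ with S ≠ u and S ≠ S*, and set k = (S − u)/(S − S*). Define the state vector Q = (m₁, m₂, ρu, ρv, E, α₁) ∈ ℝ⁶, the flux F = (m₁u, m₂u, ρu² + p, ρuv, (E + p)u, α₁u) ∈ ℝ⁶, and the HLLC star state Q* = k·( m₁, m₂, ρ·S*, ρ·v, E + (S* − u)·(ρ·S* + p/(S − u)), α₁ ) ∈ ℝ⁶. Let ρ* = k·ρ, let E* be the fifth component of Q*, and let p* = p + ρ·(S − u)·(S* − u). Then F + S·(Q* − Q) = ( k·m₁·S*, k·m₂·S*, ρ*·(S*)² + p*, ρ*·S*·v, (E* + p*)·S*, k·α₁·S* ). In other words, for the five-equation two-fluid model the HLLC intermediate flux equals the physical flux of the star state, in which both partial densities, the mixture density and the volume fraction are scaled by the common factor k and advected with speed S*. -/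
/-- for the five-equation two-fluid model, the HLLC
intermediate flux `F + S (Q* − Q)` equals the physical flux of the star
state, in which both partial densities, the mixture density and the volume
fraction are scaled by the common factor `k` and advected with speed `S*`. -/
theorem hllc_intermediate_flux_two_fluid
    (m₁ m₂ α₁ u v p E S Sstar : ℝ) (hρ : 0 < m₁ + m₂)
    (hSu : S ≠ u) (hSS : S ≠ Sstar) :
    let ρ : ℝ := m₁ + m₂
    let k : ℝ := (S - u) / (S - Sstar)
    let Q : Fin 6 → ℝ := ![m₁, m₂, ρ * u, ρ * v, E, α₁]
    let F : Fin 6 → ℝ := ![m₁ * u, m₂ * u, ρ * u ^ 2 + p, ρ * u * v, (E + p) * u, α₁ * u]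
    let Qstar : Fin 6 → ℝ :=
      k • ![m₁, m₂, ρ * Sstar, ρ * v, E + (Sstar - u) * (ρ * Sstar + p / (S - u)), α₁]
    let ρstar : ℝ := k * ρ
    let Estar : ℝ := Qstar 4
    let pstar : ℝ := p + ρ * (S - u) * (Sstar - u)
    F + S • (Qstar - Q)
      = ![k * m₁ * Sstar, k * m₂ * Sstar, ρstar * Sstar ^ 2 + pstar,
          ρstar * Sstar * v, (Estar + pstar) * Sstar, k * α₁ * Sstar] := by
  intro ρ k Q F Qstar ρstar Estar pstar
  have hu : S - u ≠ 0 := sub_ne_zero.mpr hSu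
  have hs : S - Sstar ≠ 0 := sub_ne_zero.mpr hSS
  ext i
  fin_cases i <;>
    simp [ρ, k, Q, F, Qstar, ρstar, Estar, pstar] <;>
    field_simp <;>
    ring
end
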